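/- arXiv:2505.05079 — 3 statements merged into one kernel-verified Lean document; each statement's English description precedes it below -/
import Mathlib

section
/- For all integers k ≥ 2 and n ≥ 2k−1, spt_{k−1}'^{do}(n−1) − spt_k'^{do}(n) = spt_{k−1}'^{do}(n−2k+1) + p'_{do}(n−2k+1), where spt_j'^{do}(m) is taken to be 0 for m < j (in particular spt_j'^{do}(0) = 0). -/
/-!
Definitions following Andrews–El Bachraoui / Chen–Chen–Zhao:
partitions with repeated smallest part.
-/

/-- The smallest part of `π` occurs exactly `k` times and all remaining parts
occur exactly once (are distinct). -/
def IsSptD (k : ℕ) {n : ℕ} (π : n.Partition) : Prop :=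
  ∃ s ∈ π.parts, (∀ x ∈ π.parts, s ≤ x) ∧ Multiset.count s π.parts = k ∧
    ∀ x ∈ π.parts, x ≠ s → Multiset.count x π.parts = 1

/-- `spt k_d(n)`: the number of partitions of `n` whose smallest part occurs
exactly `k` times and whose remaining parts are distinct. -/
noncomputable def sptd (k n : ℕ) : ℕ :=
  Nat.card {π : n.Partition // IsSptD k π}

/-- The smallest part `s` of `π` occurs exactly `k` times, and all remaining parts
occur exactly once and are incongruent to `s` modulo 2. -/
def IsSptDO (k : ℕ) {n : ℕ} (π : n.Partition) : Prop :=
  ∃ s ∈ π.parts, (∀ x ∈ π.parts, s ≤ x) ∧ Multiset.count s π.parts = k ∧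
    ∀ x ∈ π.parts, x ≠ s → Multiset.count x π.parts = 1 ∧ ¬ x % 2 = s % 2

/-- `spt k_{do}(n)`. -/
noncomputable def sptdo (k n : ℕ) : ℕ :=
  Nat.card {π : n.Partition // IsSptDO k π}

/-- As `IsSptDO`, with in addition an even number of parts strictly greater
than the smallest part. -/
def IsSptDOEven (k : ℕ) {n : ℕ} (π : n.Partition) : Prop :=
  ∃ s ∈ π.parts, (∀ x ∈ π.parts, s ≤ x) ∧ Multiset.count s π.parts = k ∧
    (∀ x ∈ π.parts, x ≠ s → Multiset.count x π.parts = 1 ∧ ¬ x % 2 = s % 2) ∧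
    Even (Multiset.card (π.parts.filter fun x => s < x))

/-- As `IsSptDO`, with in addition an odd number of parts strictly greater
than the smallest part. -/
def IsSptDOOdd (k : ℕ) {n : ℕ} (π : n.Partition) : Prop :=
  ∃ s ∈ π.parts, (∀ x ∈ π.parts, s ≤ x) ∧ Multiset.count s π.parts = k ∧
    (∀ x ∈ π.parts, x ≠ s → Multiset.count x π.parts = 1 ∧ ¬ x % 2 = s % 2) ∧
    Odd (Multiset.card (π.parts.filter fun x => s < x))

/-- `B₀(k,n)`. -/
noncomputable def B0 (k n : ℕ) : ℕ :=
  Nat.card {π : n.Partition // IsSptDOEven k π}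

/-- `B₁(k,n)`. -/
noncomputable def B1 (k n : ℕ) : ℕ :=
  Nat.card {π : n.Partition // IsSptDOOdd k π}

/-- `spt k'_{do}(n) = B₀(k,n) - B₁(k,n)`. -/
noncomputable def sptdo' (k n : ℕ) : ℤ :=
  (B0 k n : ℤ) - (B1 k n : ℤ)

/-- `p_d(n)`: number of partitions of `n` into distinct parts. -/
noncomputable def pd (n : ℕ) : ℕ :=
  Nat.card {π : n.Partition // π.parts.Nodup}

/-- `p_{de}(n)`: number of partitions of `n` into distinct even parts. -/
noncomputable def pde (n : ℕ) : ℕ :=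
  Nat.card {π : n.Partition // π.parts.Nodup ∧ ∀ x ∈ π.parts, Even x}

/-- `p_{do}(n)`: number of partitions of `n` into distinct odd parts. -/
noncomputable def pdo (n : ℕ) : ℕ :=
  Nat.card {π : n.Partition // π.parts.Nodup ∧ ∀ x ∈ π.parts, Odd x}

/-- `p'_{do}(n)`: partitions of `n` into an even number of distinct odd parts
minus those into an odd number of distinct odd parts. -/
noncomputable def pdo' (n : ℕ) : ℤ :=
  (Nat.card {π : n.Partition //
      π.parts.Nodup ∧ (∀ x ∈ π.parts, Odd x) ∧ Even (Multiset.card π.parts)} : ℤ) -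
  (Nat.card {π : n.Partition //
      π.parts.Nodup ∧ (∀ x ∈ π.parts, Odd x) ∧ Odd (Multiset.card π.parts)} : ℤ)

open Polynomial Finset

/-- The integers in `(s, N)` of parity opposite to that of `s`. -/
def oppositeParts (N s : ℕ) : Finset ℕ :=
  (range N).filter fun x => s < x ∧ ¬ x % 2 = s % 2

/-- The generating polynomial `∏ (1 - X ^ x)` over `oppositeParts N s`, which counts the finite
sets of such parts with sign. -/
noncomputable def oppositeProd (N s : ℕ) : ℤ[X] :=
  ∏ x ∈ oppositeParts N s, (1 - X ^ x)

theorem oppositeProd_eq (N s : ℕ) (hs : s + 1 < N) :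
    oppositeProd N s = (1 - X ^ (s + 1)) * oppositeProd N (s + 2) := by
  have h : oppositeParts N s = insert (s + 1) (oppositeParts N (s + 2)) := by
    ext x
    simp only [oppositeParts, mem_filter, mem_range, mem_insert]
    omega
  rw [oppositeProd, h, prod_insert (by simp [oppositeParts]), oppositeProd]

/-- Signed generating polynomial of pairs (smallest part at most `M`, repeated `k` times;
set of larger parts below `N`). -/
noncomputable def sptPoly (N M k : ℕ) : ℤ[X] :=
  ∑ i ∈ range M, X ^ (k * (i + 1)) * oppositeProd N (i + 1)

theorem sptPoly_recurrence (N j L : ℕ) (hL : L + 1 < N) :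
    sptPoly N (L + 2) (j + 1) + X ^ (2 * j + 1) * (sptPoly N L j + oppositeProd N 0) =
      X * sptPoly N (L + 2) j := by
  induction L with
  | zero =>
    have h := oppositeProd_eq N 0 (by omega)
    simp only [sptPoly, sum_range_succ, sum_range_zero, h]
    ring
  | succ L ih =>
    have ih := ih (by omega)
    have h := oppositeProd_eq N (L + 1) (by omega)
    have e : ∀ M k, sptPoly N (M + 1) k =
        sptPoly N M k + X ^ (k * (M + 1)) * oppositeProd N (M + 1) :=
      fun M k => sum_range_succ _ _
    rw [e (L + 2), e (L + 2), e L, h]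
    linear_combination ih

theorem prod_pow_eq_pow_sum_self {R : Type*} [CommMonoid R] (a : R) (T : Finset ℕ) :
    ∏ x ∈ T, a ^ x = a ^ ∑ x ∈ T, x :=
  prod_pow_eq_pow_sum T (fun x => x) a

theorem coeff_prod_one_sub_X_pow (A : Finset ℕ) (m : ℕ) :
    (∏ x ∈ A, (1 - X ^ x : ℤ[X])).coeff m =
      ∑ T ∈ A.powerset with ∑ x ∈ T, x = m, (-1 : ℤ) ^ #T := by
  have h : ∏ x ∈ A, (1 - X ^ x : ℤ[X]) =
      ∑ T ∈ A.powerset, C ((-1 : ℤ) ^ #T) * X ^ (∑ x ∈ T, x) := by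
    simp only [sub_eq_add_neg, prod_one_add, prod_neg, map_pow, map_neg, map_one,
      prod_pow_eq_pow_sum_self]
  rw [h, finsetSum_coeff, sum_filter]
  refine sum_congr rfl fun T _ => ?_
  rw [coeff_C_mul_X_pow]
  simp only [eq_comm]

theorem card_even_sub_card_odd {α : Type*} (S : Finset α) (f : α → ℕ) :
    (#{a ∈ S | Even (f a)} : ℤ) - #{a ∈ S | Odd (f a)} = ∑ a ∈ S, (-1 : ℤ) ^ f a := by
  rw [card_filter, card_filter]
  push_cast
  rw [← sum_sub_distrib]
  refine sum_congr rfl fun a _ => ?_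
  rcases Nat.even_or_odd (f a) with h | h
  · simp [h, Nat.not_odd_iff_even.mpr h]
  · simp [h, Nat.not_even_iff_odd.mpr h]

/-- Pairs `⟨i, T⟩` encoding the partition with `k` parts `i + 1` and set `T` of larger parts. -/
def sptPairs (N M k n : ℕ) : Finset (Σ _ : ℕ, Finset ℕ) :=
  ((range M).sigma fun i => (oppositeParts N (i + 1)).powerset).filter
    fun a => k * (a.1 + 1) + ∑ x ∈ a.2, x = n

theorem coeff_sptPoly (N M k n : ℕ) :
    (sptPoly N M k).coeff n = ∑ a ∈ sptPairs N M k n, (-1 : ℤ) ^ #a.2 := by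
  rw [sptPairs, sum_filter, sum_sigma, sptPoly, finsetSum_coeff]
  refine sum_congr rfl fun i _ => ?_
  rw [coeff_X_pow_mul']
  split_ifs with h
  · rw [oppositeProd, coeff_prod_one_sub_X_pow, sum_filter]
    refine sum_congr rfl fun T _ => ?_
    congr 1
    simp only [eq_iff_iff]
    omega
  · refine (sum_eq_zero fun T _ => if_neg ?_).symm
    simp only
    omega

theorem mem_sptPairs {N M k n : ℕ} {a : Σ _ : ℕ, Finset ℕ} :
    a ∈ sptPairs N M k n ↔ (a.1 < M ∧ ∀ x ∈ a.2, x < N ∧ a.1 + 1 < x ∧ ¬ x % 2 = (a.1 + 1) % 2) ∧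
      k * (a.1 + 1) + ∑ x ∈ a.2, x = n := by
  simp [sptPairs, oppositeParts, subset_iff]

theorem card_spt_partitions (N M k n : ℕ) (hk : 0 < k) (hN : n < N) (hM : n ≤ M)
    (p : ℕ → Prop) [DecidablePred p] :
    Nat.card {π : n.Partition // ∃ s ∈ π.parts, (∀ x ∈ π.parts, s ≤ x) ∧
      Multiset.count s π.parts = k ∧
      (∀ x ∈ π.parts, x ≠ s → Multiset.count x π.parts = 1 ∧ ¬ x % 2 = s % 2) ∧
      p (Multiset.card (π.parts.filter fun x => s < x))} =
    #{a ∈ sptPairs N M k n | p #a.2} := by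
  rw [← Fintype.card_coe, ← Nat.card_eq_fintype_card]
  symm
  have key (a : {a ∈ sptPairs N M k n | p #a.2}) :
      (∀ x ∈ a.1.2, x < N ∧ a.1.1 + 1 < x ∧ ¬ x % 2 = (a.1.1 + 1) % 2) ∧
        k * (a.1.1 + 1) + ∑ x ∈ a.1.2, x = n ∧ p #a.1.2 := by
    have h := mem_filter.mp a.2
    rw [mem_sptPairs] at h
    exact ⟨h.1.1.2, h.1.2, h.2⟩
  refine Nat.card_eq_of_bijective (fun a => ⟨⟨Multiset.replicate k (a.1.1 + 1) + a.1.2.val,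
    fun {x} hx => ?_, ?_⟩, a.1.1 + 1, ?_, fun x hx => ?_, ?_, fun x hx hxs => ?_, ?_⟩)
    ⟨fun a b hab => ?_, fun π => ?_⟩
  · rcases Multiset.mem_add.mp hx with h | h
    · rw [Multiset.eq_of_mem_replicate h]
      omega
    · have := (key a).1 x h
      omega
  · rw [Multiset.sum_add, Multiset.sum_replicate, sum_val, smul_eq_mul]
    exact (key a).2.1
  · exact Multiset.mem_add.mpr (.inl (Multiset.mem_replicate.mpr ⟨hk.ne', rfl⟩))
  · rcases Multiset.mem_add.mp hx with h | h
    · rw [Multiset.eq_of_mem_replicate h]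
    · have := (key a).1 x h
      omega
  · have h : a.1.1 + 1 ∉ a.1.2.val := fun h => by
      have := (key a).1 _ h
      omega
    rw [Multiset.count_add, Multiset.count_replicate_self, Multiset.count_eq_zero_of_notMem h,
      add_zero]
  · rcases Multiset.mem_add.mp hx with h | h
    · exact absurd (Multiset.eq_of_mem_replicate h) hxs
    · refine ⟨?_, ((key a).1 x h).2.2⟩
      rw [Multiset.count_add, Multiset.count_replicate, if_neg (Ne.symm hxs), zero_add,
        Multiset.count_eq_one_of_mem a.1.2.nodup h]
  · rw [Multiset.filter_add, Multiset.filter_eq_nil.mpr, zero_add, Multiset.filter_eq_self.mpr]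
    · exact (key a).2.2
    · exact fun x h => ((key a).1 x h).2.1
    · intro x h
      rw [Multiset.eq_of_mem_replicate h]
      exact lt_irrefl _
  · have hab : Multiset.replicate k (a.1.1 + 1) + a.1.2.val =
        Multiset.replicate k (b.1.1 + 1) + b.1.2.val := congrArg (fun π => π.1.parts) hab
    have ha : a.1.1 + 1 ∈ Multiset.replicate k (b.1.1 + 1) + b.1.2.val :=
      hab ▸ Multiset.mem_add.mpr (.inl (Multiset.mem_replicate.mpr ⟨hk.ne', rfl⟩))
    have hb : b.1.1 + 1 ∈ Multiset.replicate k (a.1.1 + 1) + a.1.2.val :=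
      hab ▸ Multiset.mem_add.mpr (.inl (Multiset.mem_replicate.mpr ⟨hk.ne', rfl⟩))
    have h1 : a.1.1 = b.1.1 := by
      rcases Multiset.mem_add.mp ha with h | h
      · exact Nat.succ_injective (Multiset.eq_of_mem_replicate h)
      · rcases Multiset.mem_add.mp hb with h' | h'
        · exact (Nat.succ_injective (Multiset.eq_of_mem_replicate h')).symm
        · have := (key b).1 _ h
          have := (key a).1 _ h'
          omega
    rw [h1] at hab
    exact Subtype.ext (Sigma.ext h1 (heq_of_eq (val_injective (add_left_cancel hab))))
  · obtain ⟨π, s, hs, hmin, hcount, hdist, hp⟩ := π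
    have hpos := π.parts_pos hs
    obtain ⟨i, rfl⟩ : ∃ i, s = i + 1 := ⟨s - 1, by omega⟩
    have hnodup : (π.parts.filter fun x => i + 1 < x).Nodup := by
      refine Multiset.nodup_iff_count_le_one.mpr fun x => ?_
      rw [Multiset.count_filter]
      split_ifs with h
      · by_cases hx : x ∈ π.parts
        · exact (hdist x hx h.ne').1.le
        · simp [Multiset.count_eq_zero_of_notMem hx]
      · exact zero_le_one
    have hparts : Multiset.replicate k (i + 1) + π.parts.filter (fun x => i + 1 < x) =
        π.parts := by
      ext x
      rw [Multiset.count_add, Multiset.count_replicate, Multiset.count_filter]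
      by_cases hx : x ∈ π.parts
      · rcases (hmin x hx).eq_or_lt with h | h
        · subst h
          simp [hcount]
        · simp [h, h.ne]
      · have : i + 1 ≠ x := fun h => hx (h ▸ hs)
        simp [Multiset.count_eq_zero_of_notMem hx, this]
    have hsum : k * (i + 1) + (π.parts.filter fun x => i + 1 < x).sum = n := by
      have h := congrArg Multiset.sum hparts
      rwa [Multiset.sum_add, Multiset.sum_replicate, smul_eq_mul, π.parts_sum] at h
    have hle : ∀ x ∈ π.parts, x ≤ n := fun x hx => π.parts_sum ▸ Multiset.le_sum_of_mem hx
    refine ⟨⟨⟨i, ⟨_, hnodup⟩⟩, mem_filter.mpr ⟨mem_sptPairs.mpr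
      ⟨⟨(hle _ hs).trans hM, fun x hx => ?_⟩, ?_⟩, hp⟩⟩, ?_⟩
    · obtain ⟨hx, hlt⟩ := Multiset.mem_filter.mp (mem_mk.mp hx)
      exact ⟨(hle x hx).trans_lt hN, hlt, (hdist x hx hlt.ne').2⟩
    · rw [Finset.sum, Multiset.map_id']
      exact hsum
    · exact Subtype.ext (Nat.Partition.ext hparts)

theorem sptdo'_eq_coeff (N M k n : ℕ) (hk : 0 < k) (hN : n < N) (hM : n ≤ M) :
    sptdo' k n = (sptPoly N M k).coeff n := by
  rw [coeff_sptPoly, ← card_even_sub_card_odd, ← card_spt_partitions N M k n hk hN hM,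
    ← card_spt_partitions N M k n hk hN hM]
  rfl

theorem card_distinct_odd_partitions (N n : ℕ) (hN : n < N) (p : ℕ → Prop) [DecidablePred p] :
    Nat.card {π : n.Partition // π.parts.Nodup ∧ (∀ x ∈ π.parts, Odd x) ∧
      p (Multiset.card π.parts)} =
    #{T ∈ (oppositeParts N 0).powerset.filter (fun T => ∑ x ∈ T, x = n) | p #T} := by
  rw [← Fintype.card_coe, ← Nat.card_eq_fintype_card]
  refine Nat.card_eq_of_bijective (fun π => ⟨⟨π.1.parts, π.2.1⟩, ?_⟩)
    ⟨fun a b hab => ?_, fun T => ?_⟩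
  · simp only [mem_filter, mem_powerset, subset_iff, oppositeParts, mem_range, mem_mk]
    refine ⟨⟨fun x hx => ⟨?_, π.1.parts_pos hx, ?_⟩, ?_⟩, π.2.2.2⟩
    · exact (π.1.parts_sum ▸ Multiset.le_sum_of_mem hx : x ≤ n).trans_lt hN
    · have := Nat.odd_iff.mp (π.2.2.1 x hx)
      omega
    · rw [Finset.sum, Multiset.map_id']
      exact π.1.parts_sum
  · exact Subtype.ext (Nat.Partition.ext (congrArg (fun T => T.1.val) hab))
  · obtain ⟨T, hT⟩ := T
    simp only [mem_filter, mem_powerset, subset_iff, oppositeParts, mem_range] at hT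
    obtain ⟨⟨hT, hsum⟩, hp⟩ := hT
    refine ⟨⟨⟨T.val, fun {x} hx => (hT hx).2.1, by rw [sum_val]; exact hsum⟩, T.nodup,
      fun x hx => Nat.odd_iff.mpr ?_, hp⟩, rfl⟩
    have := hT hx
    omega

theorem pdo'_eq_coeff (N n : ℕ) (hN : n < N) : pdo' n = (oppositeProd N 0).coeff n := by
  rw [oppositeProd, coeff_prod_one_sub_X_pow, ← card_even_sub_card_odd,
    ← card_distinct_odd_partitions N n hN, ← card_distinct_odd_partitions N n hN]
  rfl

theorem statement15 (k n : ℕ) (hk : 2 ≤ k) (hn : 2 * k - 1 ≤ n) :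
    sptdo' (k - 1) (n - 1) - sptdo' k n =
      sptdo' (k - 1) (n + 1 - 2 * k) + pdo' (n + 1 - 2 * k) := by
  obtain ⟨j, rfl⟩ : ∃ j, k = j + 1 := ⟨k - 1, by omega⟩
  obtain ⟨m, rfl⟩ : ∃ m, n = m + (2 * j + 1) := ⟨n - (2 * j + 1), by omega⟩
  set n := m + (2 * j + 1) with hn_def
  have h := congrArg (fun f => coeff f n) (sptPoly_recurrence (n + 2) j n (by omega))
  have hX : (X * sptPoly (n + 2) (n + 2) j).coeff n =
      (sptPoly (n + 2) (n + 2) j).coeff (n - 1) := by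
    obtain ⟨r, hr⟩ : ∃ r, n = r + 1 := ⟨n - 1, by omega⟩
    rw [hr, coeff_X_mul, Nat.add_sub_cancel]
  have hXp (f : ℤ[X]) : (X ^ (2 * j + 1) * f).coeff n = f.coeff m := coeff_X_pow_mul f _ m
  simp only [coeff_add, hX, hXp] at h
  rw [Nat.add_sub_cancel, show n + 1 - 2 * (j + 1) = m by omega,
    sptdo'_eq_coeff (n + 2) (n + 2) j (n - 1) (by omega) (by omega) (by omega),
    sptdo'_eq_coeff (n + 2) (n + 2) (j + 1) n (by omega) (by omega) (by omega),
    sptdo'_eq_coeff (n + 2) n j m (by omega) (by omega) (by omega),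
    pdo'_eq_coeff (n + 2) m (by omega)]
  linear_combination -h
end

section
/- For all integers k ≥ 2 and n ≥ 2k−1, spt_k^{do}(n) + spt_{k−1}^{do}(n−1) = spt_{k−1}^{do}(n−2k+1) + 2·p_{de}(n−k) + p_{do}(n−2k+1), where spt_j^{do}(m) is taken to be 0 for m < j (in particular spt_j^{do}(0) = 0). -/
/-- The finite sets `T` of natural numbers that are at least `a` and congruent to `a` modulo 2,
with `j + ∑ x ∈ T, x = n`. -/
def parityFinsets (a j n : ℕ) : Finset (Finset ℕ) :=
  {T ∈ (Finset.range (n + 1)).powerset |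
    (∀ x ∈ T, a ≤ x ∧ x % 2 = a % 2) ∧ j + ∑ x ∈ T, x = n}

theorem mem_parityFinsets {a j n : ℕ} {T : Finset ℕ} :
    T ∈ parityFinsets a j n ↔ (∀ x ∈ T, a ≤ x ∧ x % 2 = a % 2) ∧ j + ∑ x ∈ T, x = n := by
  simp only [parityFinsets, Finset.mem_filter, Finset.mem_powerset, and_iff_right_iff_imp]
  rintro ⟨-, h⟩ x hx
  have := Finset.single_le_sum (f := fun x : ℕ => x) (fun _ _ => Nat.zero_le _) hx
  rw [Finset.mem_range]
  omega

theorem parityFinsets_add_right (a j n d : ℕ) :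
    parityFinsets a (j + d) (n + d) = parityFinsets a j n := by
  ext T
  simp only [mem_parityFinsets]
  refine and_congr_right fun _ => ?_
  omega

/-- Splitting according to whether the least admissible element `a` is used. -/
theorem card_parityFinsets (a j n : ℕ) :
    (parityFinsets a j n).card =
      (parityFinsets (a + 2) j n).card + (parityFinsets (a + 2) (j + a) n).card := by
  have notMem {j T} (hT : T ∈ parityFinsets (a + 2) j n) : a ∉ T := fun ha => by
    have := ((mem_parityFinsets.1 hT).1 a ha).1
    omega
  rw [← Finset.card_filter_add_card_filter_not (s := parityFinsets a j n) (fun T => a ∉ T)]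
  congr 1
  · congr 1
    ext T
    simp only [Finset.mem_filter, mem_parityFinsets]
    constructor
    · rintro ⟨⟨h, hs⟩, ha⟩
      refine ⟨fun x hx => ?_, hs⟩
      have := h x hx
      have : x ≠ a := fun e => ha (e ▸ hx)
      omega
    · rintro ⟨h, hs⟩
      refine ⟨⟨fun x hx => ?_, hs⟩, notMem (mem_parityFinsets.2 ⟨h, hs⟩)⟩
      have := h x hx
      omega
  · refine Finset.card_nbij' (fun T => T.erase a) (fun T => insert a T) ?_ ?_ ?_ ?_
    · intro T hT
      simp only [Finset.coe_filter, Set.mem_ofPred_eq, mem_parityFinsets, not_not] at hT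
      obtain ⟨⟨h, hs⟩, ha⟩ := hT
      refine mem_parityFinsets.2 ⟨fun x hx => ?_, ?_⟩
      · have := h x (Finset.mem_of_mem_erase hx)
        have := Finset.ne_of_mem_erase hx
        omega
      · have := Finset.add_sum_erase T (fun x => x) ha
        dsimp only
        omega
    · intro T hT
      have ha := notMem hT
      obtain ⟨h, hs⟩ := mem_parityFinsets.1 hT
      simp only [Finset.coe_filter, Set.mem_ofPred_eq, mem_parityFinsets, not_not]
      refine ⟨⟨fun x hx => ?_, ?_⟩, Finset.mem_insert_self a T⟩
      · rcases Finset.mem_insert.1 hx with rfl | hx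
        · exact ⟨le_rfl, rfl⟩
        · have := h x hx
          omega
      · rw [Finset.sum_insert ha]
        omega
    · intro T hT
      simp only [Finset.coe_filter, Set.mem_ofPred_eq, not_not] at hT
      exact Finset.insert_erase hT.2
    · intro T hT
      exact Finset.erase_insert (notMem hT)

theorem card_partition_nodup_eq_card_parityFinsets {n a : ℕ} {P : ℕ → Prop} (ha : 0 < a)
    (hP : ∀ x, 0 < x → (P x ↔ a ≤ x ∧ x % 2 = a % 2)) :
    Nat.card {π : n.Partition // π.parts.Nodup ∧ ∀ x ∈ π.parts, P x} =
      (parityFinsets a 0 n).card := by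
  rw [← Nat.card_eq_finsetCard]
  refine Nat.card_eq_of_bijective
    (fun π => ⟨⟨π.1.parts, π.2.1⟩, mem_parityFinsets.2
      ⟨fun x hx => (hP x (π.1.parts_pos hx)).1 (π.2.2 x hx), ?_⟩⟩) ⟨?_, ?_⟩
  · rw [Finset.sum_eq_multiset_sum, Multiset.map_id', zero_add]
    exact π.1.parts_sum
  · intro π ρ h
    exact Subtype.ext (Nat.Partition.ext (congrArg (fun T => T.1.val) h))
  · rintro ⟨T, hT⟩
    obtain ⟨h, hs⟩ := mem_parityFinsets.1 hT
    rw [Finset.sum_eq_multiset_sum, Multiset.map_id', zero_add] at hs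
    have hpos {x} (hx : x ∈ T.val) : 0 < x := ha.trans_le (h x hx).1
    exact ⟨⟨⟨T.val, hpos, hs⟩, T.nodup, fun x hx => (hP x (hpos hx)).2 (h x hx)⟩, rfl⟩

theorem pde_eq_card (n : ℕ) : pde n = (parityFinsets 2 0 n).card :=
  card_partition_nodup_eq_card_parityFinsets two_pos fun x hx => by
    rw [Nat.even_iff]
    omega

theorem pdo_eq_card (n : ℕ) : pdo n = (parityFinsets 1 0 n).card :=
  card_partition_nodup_eq_card_parityFinsets one_pos fun x hx => by
    rw [Nat.odd_iff]
    omega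

/-- Classification by the smallest part `i + 1`; indices `i ≥ n` contribute nothing. -/
theorem sptdo_eq_sum {k n N : ℕ} (hk : 1 ≤ k) (hN : n ≤ N) :
    sptdo k n = ∑ i ∈ Finset.range N, (parityFinsets (i + 2) (k * (i + 1)) n).card := by
  rw [← Finset.card_sigma, ← Nat.card_eq_finsetCard]
  symm
  have key (p : (Finset.range N).sigma fun i => parityFinsets (i + 2) (k * (i + 1)) n) :=
    mem_parityFinsets.1 (Finset.mem_sigma.1 p.2).2
  let f (p : (Finset.range N).sigma fun i => parityFinsets (i + 2) (k * (i + 1)) n) :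
      {π : n.Partition // IsSptDO k π} :=
    ⟨{ parts := Multiset.replicate k (p.1.1 + 1) + p.1.2.val
       parts_pos := by
        intro x hx
        rcases Multiset.mem_add.1 hx with hx | hx
        · rw [Multiset.eq_of_mem_replicate hx]
          omega
        · have := (key p).1 x hx
          omega
       parts_sum := by
        have := (key p).2
        rw [Finset.sum_eq_multiset_sum, Multiset.map_id'] at this
        simpa using this }, by
      obtain ⟨h, -⟩ := key p
      have hne : p.1.1 + 1 ∉ p.1.2.val := fun hx => by
        have := (h _ hx).1
        omega
      refine ⟨p.1.1 + 1, Multiset.mem_add.2 (.inl (Multiset.mem_replicate.2 ⟨by omega, rfl⟩)),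
        fun x hx => ?_, ?_, fun x hx hxs => ?_⟩
      · rcases Multiset.mem_add.1 hx with hx | hx
        · exact (Multiset.eq_of_mem_replicate hx).ge
        · have := (h x hx).1
          omega
      · simp [Multiset.count_eq_zero_of_notMem hne]
      · rcases Multiset.mem_add.1 hx with hx | hx
        · exact absurd (Multiset.eq_of_mem_replicate hx) hxs
        · refine ⟨?_, ?_⟩
          · rw [Multiset.count_add, Multiset.count_replicate, if_neg (Ne.symm hxs),
              Multiset.count_eq_one_of_mem p.1.2.nodup hx]
          · have := (h x hx).2
            omega⟩
  refine Nat.card_eq_of_bijective f ⟨?_, ?_⟩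
  · have le_of_eq {p q} (h : f p = f q) : q.1.1 ≤ p.1.1 := by
      have hparts : Multiset.replicate k (p.1.1 + 1) + p.1.2.val =
          Multiset.replicate k (q.1.1 + 1) + q.1.2.val :=
        congrArg (fun π => π.1.parts) h
      have hp : p.1.1 + 1 ∈ Multiset.replicate k (q.1.1 + 1) + q.1.2.val :=
        hparts ▸ Multiset.mem_add.2 (.inl (Multiset.mem_replicate.2 ⟨by omega, rfl⟩))
      rcases Multiset.mem_add.1 hp with hp | hp
      · have := Multiset.eq_of_mem_replicate hp
        omega
      · have := ((key q).1 _ hp).1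
        omega
    intro p q h
    have hi := (le_of_eq h.symm).antisymm (le_of_eq h)
    have hparts : Multiset.replicate k (p.1.1 + 1) + p.1.2.val =
        Multiset.replicate k (q.1.1 + 1) + q.1.2.val :=
      congrArg (fun π => π.1.parts) h
    rw [hi] at hparts
    exact Subtype.ext (Sigma.ext hi (heq_of_eq (Finset.val_injective (add_left_cancel hparts))))
  · rintro ⟨π, s, hs, hmin, hcount, hrest⟩
    have hspos := π.parts_pos hs
    have hnodup : (π.parts.filter (· ≠ s)).Nodup := by
      refine Multiset.nodup_iff_count_le_one.2 fun x => ?_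
      by_cases hx : x ∈ π.parts.filter (· ≠ s)
      · obtain ⟨hx, hxs⟩ := Multiset.mem_filter.1 hx
        exact (Multiset.count_le_of_le _ (Multiset.filter_le _ _)).trans (hrest x hx hxs).1.le
      · rw [Multiset.count_eq_zero_of_notMem hx]
        exact zero_le_one
    have hsplit : Multiset.replicate k s + π.parts.filter (· ≠ s) = π.parts := by
      rw [← hcount, ← Multiset.filter_eq']
      exact Multiset.filter_add_not _ _
    have hsum : k * s + (π.parts.filter (· ≠ s)).sum = n := by
      conv_rhs => rw [← π.parts_sum, ← hsplit]
      simp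
    have hs' : s - 1 + 1 = s := by omega
    refine ⟨⟨⟨s - 1, ⟨π.parts.filter (· ≠ s), hnodup⟩⟩, Finset.mem_sigma.2 ⟨?_, ?_⟩⟩, ?_⟩
    · have : s ≤ k * s := Nat.le_mul_of_pos_left s hk
      simp only [Finset.mem_range]
      omega
    · refine mem_parityFinsets.2 ⟨fun x hx => ?_, ?_⟩
      · obtain ⟨hx, hxs⟩ := Multiset.mem_filter.1 hx
        have := (hrest x hx hxs).2
        have := hmin x hx
        dsimp only
        omega
      · rw [Finset.sum_eq_multiset_sum, Multiset.map_id']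
        simpa only [hs'] using hsum
    · refine Subtype.ext (Nat.Partition.ext ?_)
      simpa only [f, hs'] using hsplit

theorem statement16 (k n : ℕ) (hk : 2 ≤ k) (hn : 2 * k - 1 ≤ n) :
    sptdo k n + sptdo (k - 1) (n - 1) =
      sptdo (k - 1) (n + 1 - 2 * k) + 2 * pde (n - k) + pdo (n + 1 - 2 * k) := by
  obtain ⟨k, rfl⟩ : ∃ l, k = l + 1 := ⟨k - 1, by omega⟩
  obtain ⟨m, rfl⟩ : ∃ m, n = m + (2 * k + 1) := ⟨n - (2 * k + 1), by omega⟩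
  have hn₁ : m + (2 * k + 1) - 1 = m + 2 * k := by omega
  have hn₂ : m + (2 * k + 1) + 1 - 2 * (k + 1) = m := by omega
  have hn₃ : m + (2 * k + 1) - (k + 1) = m + k := by omega
  rw [hn₁, hn₂, hn₃, Nat.add_sub_cancel, pde_eq_card, pdo_eq_card,
    sptdo_eq_sum (N := m + (2 * k + 1) + 2) (by omega) (by omega),
    sptdo_eq_sum (n := m + 2 * k) (N := m + (2 * k + 1) + 2) (by omega) (by omega),
    sptdo_eq_sum (n := m) (N := m + (2 * k + 1)) (by omega) (by omega),
    ← Finset.sum_add_distrib]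
  have hterm (i : ℕ) :
      (parityFinsets (i + 2) ((k + 1) * (i + 1)) (m + (2 * k + 1))).card +
        (parityFinsets (i + 2) (k * (i + 1)) (m + 2 * k)).card =
      (parityFinsets i (k * (i + 1) + 1) (m + (2 * k + 1))).card := by
    rw [card_parityFinsets i, ← parityFinsets_add_right (i + 2) (k * (i + 1)) (m + 2 * k) 1,
      add_comm]
    congr 3
    ring
  have hshift (i : ℕ) :
      parityFinsets (i + 1 + 1) (k * (i + 1 + 1 + 1) + 1) (m + (2 * k + 1)) =
        parityFinsets (i + 2) (k * (i + 1)) m := by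
    rw [← parityFinsets_add_right (i + 2) (k * (i + 1)) m (2 * k + 1)]
    congr 1
    ring
  have hodd : parityFinsets (0 + 1) (k * (0 + 1 + 1) + 1) (m + (2 * k + 1)) =
      parityFinsets 1 0 m := by
    rw [← parityFinsets_add_right 1 0 m (2 * k + 1)]
    congr 1
    ring
  have heven : (parityFinsets 0 (k * (0 + 1) + 1) (m + (2 * k + 1))).card =
      2 * (parityFinsets 2 0 (m + k)).card := by
    rw [card_parityFinsets, ← parityFinsets_add_right 2 0 (m + k) (k + 1), two_mul (Finset.card _)]
    congr 3 <;> ring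
  simp only [hterm, Finset.sum_range_succ', hshift, hodd, heven]
  ring
end

section
/- For all integers k ≥ 2 and n ≥ 2k−1, B_0(k−1, n−2k+1) − B_1(k−1, n−2k+1) + (−1)^{n−2k+1}·p_{do}(n−2k+1) = B_0(k−1, n−1) − B_1(k−1, n−1) − B_0(k, n) + B_1(k, n), where B_0 and B_1 are taken to vanish when their second argument is less than their first. -/
open Finset

/-- Finite sets of integers greater than `s`, of parity opposite to `s`, with sum `m`. -/
def oppParitySets (s m : ℕ) : Finset (Finset ℕ) :=
  (range (m + 1)).powerset.filter fun A =>
    (∀ x ∈ A, s < x ∧ ¬ x % 2 = s % 2) ∧ ∑ x ∈ A, x = m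

theorem mem_oppParitySets {s m : ℕ} {A : Finset ℕ} :
    A ∈ oppParitySets s m ↔ (∀ x ∈ A, s < x ∧ ¬ x % 2 = s % 2) ∧ ∑ x ∈ A, x = m := by
  simp only [oppParitySets, mem_filter, mem_powerset, and_iff_right_iff_imp]
  rintro ⟨-, h⟩ x hx
  have := single_le_sum (f := fun x : ℕ => x) (fun _ _ => Nat.zero_le _) hx
  simp only [mem_range]
  omega

/-- The signed count of `oppParitySets s (n - a)`, taken to be zero when `n < a`. -/
def signedCount (s a n : ℕ) : ℤ :=
  if a ≤ n then ∑ A ∈ oppParitySets s (n - a), (-1) ^ #A else 0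

theorem filter_notMem_oppParitySets (s m : ℕ) :
    (oppParitySets s m).filter (fun A => s + 1 ∉ A) = oppParitySets (s + 2) m := by
  ext A
  simp only [mem_filter, mem_oppParitySets]
  constructor
  · rintro ⟨⟨h, hs⟩, hA⟩
    refine ⟨fun x hx => ?_, hs⟩
    have := h x hx
    have : x ≠ s + 1 := fun h => hA (h ▸ hx)
    omega
  · rintro ⟨h, hs⟩
    refine ⟨⟨fun x hx => ?_, hs⟩, fun hx => ?_⟩
    · have := h x hx
      omega
    · have := h _ hx
      omega

theorem sum_oppParitySets_mem (s m : ℕ) :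
    ∑ A ∈ (oppParitySets s (m + (s + 1))).filter (fun A => s + 1 ∈ A), (-1 : ℤ) ^ #A =
      -∑ A ∈ oppParitySets (s + 2) m, (-1) ^ #A := by
  rw [← sum_neg_distrib]
  have key : ∀ A ∈ oppParitySets (s + 2) m, s + 1 ∉ A := fun A hA hx => by
    have := (mem_oppParitySets.1 hA).1 _ hx
    omega
  symm
  refine sum_bij' (fun A _ => insert (s + 1) A) (fun A _ => A.erase (s + 1)) ?_ ?_ ?_ ?_ ?_
  · intro A hA
    have hn := key A hA
    rw [mem_oppParitySets] at hA
    simp only [mem_filter, mem_oppParitySets, sum_insert hn, mem_insert]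
    refine ⟨⟨fun x hx => ?_, by omega⟩, by simp⟩
    rcases hx with rfl | hx
    · omega
    · have := hA.1 x hx
      omega
  · intro A hA
    simp only [mem_filter, mem_oppParitySets] at hA ⊢
    have := add_sum_erase A (fun x => x) hA.2
    refine ⟨fun x hx => ?_, by omega⟩
    rw [mem_erase] at hx
    have := hA.1.1 x hx.2
    omega
  · intro A hA
    exact erase_insert (key A hA)
  · intro A hA
    exact insert_erase (mem_filter.1 hA).2
  · intro A hA
    rw [card_insert_of_notMem (key A hA), pow_succ]
    ring

theorem signedCount_recurrence (s a n : ℕ) :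
    signedCount s a n = signedCount (s + 2) a n - signedCount (s + 2) (a + (s + 1)) n := by
  unfold signedCount
  by_cases h : a ≤ n
  · rw [if_pos h, if_pos h, ← sum_filter_add_sum_filter_not _ (fun A => s + 1 ∈ A),
      filter_notMem_oppParitySets]
    by_cases h' : a + (s + 1) ≤ n
    · rw [if_pos h', show n - a = n - (a + (s + 1)) + (s + 1) by omega, sum_oppParitySets_mem]
      ring
    · rw [if_neg h', sum_eq_zero]
      · ring
      · intro A hA
        simp only [mem_filter, mem_oppParitySets] at hA
        have := single_le_sum (f := fun x : ℕ => x) (fun _ _ => Nat.zero_le _) hA.2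
        omega
  · rw [if_neg h, if_neg h, if_neg (by omega)]
    ring

theorem filter_lt_replicate_add {s k : ℕ} {A : Finset ℕ} (h : ∀ x ∈ A, s < x) :
    (Multiset.replicate k s + A.val).filter (fun x => s < x) = A.val := by
  rw [Multiset.filter_add, Multiset.filter_eq_nil.2, zero_add, Multiset.filter_eq_self.2]
  · exact h
  · intro x hx
    rw [Multiset.eq_of_mem_replicate hx]
    exact lt_irrefl s

theorem card_partition_eq_sum (k n N : ℕ) (hk : 1 ≤ k) (hN : n ≤ N) (e : ℕ → Prop)
    [DecidablePred e] :
    Nat.card {π : n.Partition // ∃ s ∈ π.parts, (∀ x ∈ π.parts, s ≤ x) ∧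
      Multiset.count s π.parts = k ∧
      (∀ x ∈ π.parts, x ≠ s → Multiset.count x π.parts = 1 ∧ ¬ x % 2 = s % 2) ∧
      e (Multiset.card (π.parts.filter fun x => s < x))} =
    ∑ s ∈ range N, if k * (s + 1) ≤ n then
      #((oppParitySets (s + 1) (n - k * (s + 1))).filter fun A => e #A) else 0 := by
  classical
  rw [← sum_filter, ← card_sigma, Nat.card_eq_fintype_card, Fintype.card_subtype]
  symm
  have hmem : ∀ p : (_ : ℕ) × Finset ℕ,
      p ∈ ((range N).filter fun s => k * (s + 1) ≤ n).sigma (fun s =>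
        (oppParitySets (s + 1) (n - k * (s + 1))).filter fun A => e #A) →
      (∀ x ∈ p.2, p.1 + 1 < x ∧ ¬ x % 2 = (p.1 + 1) % 2) ∧
      (∑ x ∈ p.2, x) + k * (p.1 + 1) = n ∧ e #p.2 := by
    intro p hp
    simp only [mem_sigma, mem_filter, mem_oppParitySets] at hp
    exact ⟨hp.2.1.1, by omega, hp.2.2⟩
  refine card_bij (fun p hp => (⟨Multiset.replicate k (p.1 + 1) + p.2.val, ?_, ?_⟩ :
    n.Partition)) ?_ ?_ ?_
  · intro i hi
    rcases Multiset.mem_add.1 hi with hi | hi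
    · rw [Multiset.eq_of_mem_replicate hi]
      omega
    · have := ((hmem p hp).1 i hi).1
      omega
  · have := (hmem p hp).2.1
    rw [Multiset.sum_add, Multiset.sum_replicate, smul_eq_mul, sum_val]
    simp only [id]
    omega
  · intro p hp
    obtain ⟨h1, h2, h3⟩ := hmem p hp
    have hs : p.1 + 1 ∉ p.2 := fun h => lt_irrefl _ (h1 _ h).1
    simp only [mem_filter, mem_univ, true_and]
    refine ⟨p.1 + 1, ?_, ?_, ?_, ?_, ?_⟩
    · exact Multiset.mem_add.2 (Or.inl (Multiset.mem_replicate.2 ⟨by omega, rfl⟩))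
    · intro x hx
      rcases Multiset.mem_add.1 hx with hx | hx
      · exact (Multiset.eq_of_mem_replicate hx).ge
      · exact (h1 x hx).1.le
    · rw [Multiset.count_add, Multiset.count_replicate_self, Multiset.count_eq_zero.2 hs,
        add_zero]
    · intro x hx hne
      rcases Multiset.mem_add.1 hx with hx | hx
      · exact absurd (Multiset.eq_of_mem_replicate hx) hne
      · refine ⟨?_, (h1 x hx).2⟩
        rw [Multiset.count_add, Multiset.count_replicate, if_neg hne.symm, zero_add]
        exact Multiset.count_eq_one_of_mem p.2.nodup hx
    · rw [filter_lt_replicate_add fun x hx => (h1 x hx).1]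
      exact h3
  · rintro ⟨s, A⟩ hp ⟨t, B⟩ hq h
    have hA := (hmem _ hp).1
    have hB := (hmem _ hq).1
    have h' : Multiset.replicate k (s + 1) + A.val = Multiset.replicate k (t + 1) + B.val :=
      congrArg Nat.Partition.parts h
    have hst : s = t := by
      have h1 : s + 1 ∈ Multiset.replicate k (t + 1) + B.val := by
        rw [← h']
        exact Multiset.mem_add.2 (Or.inl (Multiset.mem_replicate.2 ⟨by omega, rfl⟩))
      have h2 : t + 1 ∈ Multiset.replicate k (s + 1) + A.val := by
        rw [h']
        exact Multiset.mem_add.2 (Or.inl (Multiset.mem_replicate.2 ⟨by omega, rfl⟩))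
      rcases Multiset.mem_add.1 h1 with h1 | h1
      · have := Multiset.eq_of_mem_replicate h1
        omega
      rcases Multiset.mem_add.1 h2 with h2 | h2
      · have := Multiset.eq_of_mem_replicate h2
        omega
      have := (hA _ h2).1
      have := (hB _ h1).1
      simp only at *
      omega
    subst hst
    rw [val_injective (add_left_cancel h')]
  · intro π hπ
    simp only [mem_filter, mem_univ, true_and] at hπ
    obtain ⟨s, hs, hle, hc, hd, he⟩ := hπ
    have hpos : 0 < s := π.parts_pos hs
    obtain ⟨t, rfl⟩ : ∃ t, s = t + 1 := ⟨s - 1, by omega⟩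
    have hnd : (π.parts.filter fun x => t + 1 < x).Nodup := by
      rw [Multiset.nodup_iff_count_le_one]
      intro x
      by_cases hx : x ∈ π.parts.filter fun x => t + 1 < x
      · rw [Multiset.mem_filter] at hx
        rw [Multiset.count_filter_of_pos hx.2]
        exact (hd x hx.1 hx.2.ne').1.le
      · rw [Multiset.count_eq_zero.2 hx]
        exact Nat.zero_le _
    have hsplit : Multiset.replicate k (t + 1) + π.parts.filter (fun x => t + 1 < x) =
        π.parts := by
      rw [← hc, ← Multiset.filter_eq']
      conv_rhs => rw [← Multiset.filter_add_not (fun x => x = t + 1) π.parts]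
      congr 1
      refine Multiset.filter_congr fun x hx => ?_
      have := hle x hx
      omega
    have hsum := π.parts_sum
    rw [← hsplit, Multiset.sum_add, Multiset.sum_replicate, smul_eq_mul] at hsum
    have hkt : t + 1 ≤ k * (t + 1) := Nat.le_mul_of_pos_left _ hk
    refine ⟨⟨t, ⟨_, hnd⟩⟩, ?_, Nat.Partition.ext hsplit⟩
    simp only [mem_sigma, mem_filter, mem_range, mem_oppParitySets]
    refine ⟨⟨by omega, by omega⟩, ⟨fun x hx => ?_, ?_⟩, he⟩
    · have hx := Multiset.mem_filter.1 hx
      exact ⟨hx.2, (hd x hx.1 hx.2.ne').2⟩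
    · change ((π.parts.filter fun x => t + 1 < x).map fun x => x).sum = _
      rw [Multiset.map_id']
      omega

theorem sum_neg_one_pow_card (T : Finset (Finset ℕ)) :
    ∑ A ∈ T, (-1 : ℤ) ^ #A =
      #(T.filter fun A => Even #A) - #(T.filter fun A => Odd #A) := by
  simp only [card_filter, Nat.cast_sum, ← sum_sub_distrib]
  refine sum_congr rfl fun A _ => ?_
  rcases Nat.even_or_odd #A with h | h
  · simp [h, h.neg_one_pow, Nat.not_odd_iff_even.2 h]
  · simp [h, h.neg_one_pow, Nat.not_even_iff_odd.2 h]

theorem B0_sub_B1_eq_sum (k n N : ℕ) (hk : 1 ≤ k) (hN : n ≤ N) :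
    (B0 k n : ℤ) - B1 k n = ∑ s ∈ range N, signedCount (s + 1) (k * (s + 1)) n := by
  have h0 : B0 k n = _ := card_partition_eq_sum k n N hk hN Even
  have h1 : B1 k n = _ := card_partition_eq_sum k n N hk hN Odd
  rw [h0, h1, Nat.cast_sum, Nat.cast_sum, ← sum_sub_distrib]
  refine sum_congr rfl fun s _ => ?_
  unfold signedCount
  split_ifs
  · rw [sum_neg_one_pow_card]
  · simp

theorem neg_one_pow_mul_pdo (m : ℕ) : (-1 : ℤ) ^ m * pdo m = signedCount 0 0 m := by
  classical
  have hcard : pdo m = #(oppParitySets 0 m) := by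
    unfold pdo
    rw [Nat.card_eq_fintype_card, Fintype.card_subtype]
    refine card_bij (fun π _ => π.parts.toFinset) ?_ ?_ ?_
    · intro π hπ
      simp only [mem_filter, mem_univ, true_and] at hπ
      rw [mem_oppParitySets]
      refine ⟨fun x hx => ?_, ?_⟩
      · have hx := Multiset.mem_toFinset.1 hx
        have := Nat.odd_iff.1 (hπ.2 x hx)
        omega
      · change (π.parts.toFinset.val.map fun x => x).sum = m
        rw [Multiset.map_id', Multiset.toFinset_val, hπ.1.dedup, π.parts_sum]
    · intro π hπ ρ hρ h
      simp only [mem_filter, mem_univ, true_and] at hπ hρ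
      have h := congrArg Finset.val h
      rw [Multiset.toFinset_val, Multiset.toFinset_val, hπ.1.dedup, hρ.1.dedup] at h
      exact Nat.Partition.ext h
    · intro A hA
      rw [mem_oppParitySets] at hA
      refine ⟨⟨A.val, fun {i} hi => (hA.1 i hi).1, ?_⟩, ?_, ?_⟩
      · exact (congrArg Multiset.sum (Multiset.map_id' A.val)).symm.trans hA.2
      · simp only [mem_filter, mem_univ, true_and]
        refine ⟨A.nodup, fun x hx => Nat.odd_iff.2 ?_⟩
        have := hA.1 x hx
        omega
      · exact val_toFinset A
  have hsign : ∀ A ∈ oppParitySets 0 m, (-1 : ℤ) ^ #A = (-1) ^ m := by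
    intro A hA
    rw [mem_oppParitySets] at hA
    rw [← hA.2, ← prod_pow_eq_pow_sum, card_eq_sum_ones, ← prod_pow_eq_pow_sum]
    refine prod_congr rfl fun x hx => ?_
    have hodd : Odd x := Nat.odd_iff.2 (by have := hA.1 x hx; omega)
    rw [hodd.neg_one_pow, pow_one]
  rw [signedCount, if_pos (Nat.zero_le _), Nat.sub_zero, sum_congr rfl hsign, sum_const,
    nsmul_eq_mul, hcard, mul_comm]

theorem signedCount_add_right (s a b n : ℕ) :
    signedCount s (a + b) (n + b) = signedCount s a n := by
  unfold signedCount
  simp only [Nat.add_le_add_iff_right, Nat.add_sub_add_right]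

theorem statement17 (k n : ℕ) (hk : 2 ≤ k) (hn : 2 * k - 1 ≤ n) :
    (B0 (k - 1) (n + 1 - 2 * k) : ℤ) - B1 (k - 1) (n + 1 - 2 * k)
        + (-1) ^ (n + 1 - 2 * k) * pdo (n + 1 - 2 * k) =
      (B0 (k - 1) (n - 1) : ℤ) - B1 (k - 1) (n - 1) - B0 k n + B1 k n := by
  obtain ⟨j, rfl⟩ : ∃ j, k = j + 1 := ⟨k - 1, by omega⟩
  obtain ⟨m, rfl⟩ : ∃ m, n = m + (2 * j + 1) := ⟨n - (2 * j + 1), by omega⟩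
  rw [show m + (2 * j + 1) + 1 - 2 * (j + 1) = m by omega, Nat.add_sub_cancel,
    show m + (2 * j + 1) - 1 = m + 2 * j by omega]
  set n := m + (2 * j + 1) with hdef
  have hL : (B0 j m : ℤ) - B1 j m + (-1) ^ m * pdo m =
      ∑ s ∈ range (n + 1), signedCount s (j * s) m := by
    rw [sum_range_succ', B0_sub_B1_eq_sum j m n (by omega) (by omega), neg_one_pow_mul_pdo,
      mul_zero]
  have hR : (B0 j (m + 2 * j) : ℤ) - B1 j (m + 2 * j) - B0 (j + 1) n + B1 (j + 1) n =
      ∑ s ∈ range (n + 2), (signedCount (s + 1) (j * (s + 1) + 1) n -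
        signedCount (s + 1) ((j + 1) * (s + 1)) n) := by
    rw [sum_sub_distrib, ← B0_sub_B1_eq_sum (j + 1) n (n + 2) (by omega) (by omega),
      show n = m + 2 * j + 1 from rfl,
      sum_congr rfl fun s _ => signedCount_add_right (s + 1) (j * (s + 1)) 1 (m + 2 * j),
      ← B0_sub_B1_eq_sum j (m + 2 * j) (m + 2 * j + 1 + 2) (by omega) (by omega)]
    ring
  rw [hL, hR, sum_range_succ' _ (n + 1)]
  simp only [zero_add, mul_one, sub_self, add_zero]
  refine sum_congr rfl fun s _ => ?_
  rw [← signedCount_add_right s (j * s) (2 * j + 1) m, ← hdef, signedCount_recurrence]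
  congr 2 <;> ring
end
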